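/- In R = ℂ[x,y,u,v], let a ∈ ℂ[u,v] be homogeneous of degree 2 and β ∈ ℂ[u,v] homogeneous of degree 1. Then (a·x + β·u·y, x², x·y, y²) ∩ (x, u) = (x², x·y, u·y², a·x + β·u·y). (Here (a·x + β·u·y, x², x·y, y²) is the ideal of a double line D on a smooth cubic surface supported on L = {x = y = 0}, (x, u) is the ideal of a line ℓ meeting L, and the intersection is the ideal of the degree-3 curve Y = D ∪ ℓ.) -/

import Mathlib

open MvPolynomial

/-- Variables: `x = X 0`, `y = X 1`, `u = X 2`, `v = X 3`; `ℂ[u,v] ⊆ ℂ[x,y,u,v]`. -/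
noncomputable def embUV : MvPolynomial (Fin 2) ℂ →ₐ[ℂ] MvPolynomial (Fin 4) ℂ :=
  MvPolynomial.rename (fun i : Fin 2 => (i.succ.succ : Fin 4))

/-- An ideal generated by variables is saturated with respect to every other variable. -/
theorem MvPolynomial.mem_span_X_image_of_mul_X_pow_mem {σ R : Type*} [CommSemiring R]
    {s : Set σ} {j : σ} (hj : j ∉ s) (n : ℕ) {p : MvPolynomial σ R}
    (h : p * X j ^ n ∈ Ideal.span (X '' s : Set (MvPolynomial σ R))) :
    p ∈ Ideal.span (X '' s : Set (MvPolynomial σ R)) := by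
  classical
  rw [mem_ideal_span_X_image] at h ⊢
  intro m hm
  obtain ⟨i, hi, hmi⟩ := h (m + Finsupp.single j n) (by
    rw [mem_support_iff, X_pow_eq_monomial, coeff_mul_monomial, mul_one]
    exact mem_support_iff.mp hm)
  have hji : j ≠ i := fun e => hj (e ▸ hi)
  exact ⟨i, hi, by simpa [Finsupp.single_eq_of_ne' hji] using hmi⟩

/-- For the double line `D` with ideal `(a·x + β·u·y, x², x·y, y²)` and the line `ℓ`
with ideal `(x, u)`, the ideal of the degree-3 curve `Y = D ∪ ℓ` is
`(x², x·y, u·y², a·x + β·u·y)`. -/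
theorem double_line_union_meeting_line_ideal
    (a β : MvPolynomial (Fin 2) ℂ)
    (ha : a.IsHomogeneous 2) (hβ : β.IsHomogeneous 1) :
    Ideal.span {embUV a * X 0 + embUV β * X 2 * X 1, X 0 ^ 2, X 0 * X 1, X 1 ^ 2} ⊓
        Ideal.span ({X 0, X 2} : Set (MvPolynomial (Fin 4) ℂ))
      = Ideal.span {X 0 ^ 2, X 0 * X 1, X 2 * X 1 ^ 2,
          embUV a * X 0 + embUV β * X 2 * X 1} := by
  generalize embUV a = A
  generalize embUV β = B
  ext f
  simp only [Ideal.mem_inf, Ideal.mem_span_insert, Ideal.mem_span_singleton']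
  constructor
  · rintro ⟨⟨p, _, ⟨q, _, ⟨r, _, ⟨s, rfl⟩, rfl⟩, rfl⟩, rfl⟩, ⟨c, _, ⟨d, rfl⟩, hf⟩⟩
    have hs : s * X 1 ^ 2 ∈
        Ideal.span (X '' {0, 2} : Set (MvPolynomial (Fin 4) ℂ)) := by
      rw [Set.image_pair, Ideal.mem_span_pair]
      exact ⟨c - p * A - q * X 0 - r * X 1, d - p * B * X 1, by linear_combination -hf⟩
    have hs' := mem_span_X_image_of_mul_X_pow_mem (by decide) 2 hs
    rw [Set.image_pair, Ideal.mem_span_pair] at hs'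
    obtain ⟨s₁, s₂, rfl⟩ := hs'
    exact ⟨q, _, ⟨r + s₁ * X 1, _, ⟨s₂, _, ⟨p, rfl⟩, rfl⟩, rfl⟩, by ring⟩
  · rintro ⟨q, _, ⟨r, _, ⟨s, _, ⟨p, rfl⟩, rfl⟩, rfl⟩, rfl⟩
    exact ⟨⟨p, _, ⟨q, _, ⟨r, _, ⟨s * X 2, rfl⟩, rfl⟩, rfl⟩, by ring⟩,
      ⟨q * X 0 + r * X 1 + p * A, _, ⟨s * X 1 ^ 2 + p * B * X 1, rfl⟩, by ring⟩⟩
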